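/- Let A be a real n×n matrix and C a real p×n matrix, and suppose there exists a real symmetric positive definite n×n matrix P such that Aᵀ·P + P·A + Cᵀ·C is negative semidefinite. If the pair (C, A) is observable in the PBH sense, then A is Hurwitz, i.e., every eigenvalue of A (as a complex matrix) has strictly negative real part. -/

import Mathlib

open Matrix

/-- A real square matrix is Hurwitz if every eigenvalue (as a complex matrix)
has strictly negative real part. -/
def IsHurwitz {ι : Type*} [Fintype ι] [DecidableEq ι] (M : Matrix ι ι ℝ) : Prop :=
  ∀ lam ∈ spectrum ℂ (M.map (algebraMap ℝ ℂ)), lam.re < 0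

/-- PBH observability test for the pair (Cm, Am). -/
def PBHObservable {κ ι : Type*} [Fintype κ] [Fintype ι]
    (Cm : Matrix κ ι ℝ) (Am : Matrix ι ι ℝ) : Prop :=
  ∀ (lam : ℂ) (v : ι → ℂ), v ≠ 0 →
    (Am.map (algebraMap ℝ ℂ)) *ᵥ v = lam • v →
    (Cm.map (algebraMap ℝ ℂ)) *ᵥ v ≠ 0

/-- The real part of a real matrix acting on a complex vector. -/
theorem re_map_mulVec {κ ι : Type*} [Fintype ι] (M : Matrix κ ι ℝ) (v : ι → ℂ) (i : κ) :
    ((M.map (algebraMap ℝ ℂ) *ᵥ v) i).re = (M *ᵥ fun j => (v j).re) i := by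
  simp [mulVec, dotProduct]

/-- The imaginary part of a real matrix acting on a complex vector. -/
theorem im_map_mulVec {κ ι : Type*} [Fintype ι] (M : Matrix κ ι ℝ) (v : ι → ℂ) (i : κ) :
    ((M.map (algebraMap ℝ ℂ) *ᵥ v) i).im = (M *ᵥ fun j => (v j).im) i := by
  simp [mulVec, dotProduct]

/-- A symmetric matrix induces a symmetric bilinear form. -/
theorem Matrix.IsSymm.dotProduct_mulVec_comm {ι : Type*} [Fintype ι] {P : Matrix ι ι ℝ}
    (hP : P.IsSymm) (x y : ι → ℝ) : x ⬝ᵥ P *ᵥ y = y ⬝ᵥ P *ᵥ x := by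
  rw [dotProduct_mulVec, ← mulVec_transpose, hP.eq, dotProduct_comm]

/-- The semidefinite Lyapunov inequality, evaluated on a vector. -/
theorem lyapunov_inequality_apply {κ ι : Type*} [Fintype κ] [Fintype ι]
    {A P : Matrix ι ι ℝ} {C : Matrix κ ι ℝ} (hP : P.IsSymm)
    (h : (-(Aᵀ * P + P * A + Cᵀ * C)).PosSemidef) (x : ι → ℝ) :
    2 * (x ⬝ᵥ P *ᵥ (A *ᵥ x)) + (C *ᵥ x) ⬝ᵥ (C *ᵥ x) ≤ 0 := by
  have hx := h.dotProduct_mulVec_nonneg x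
  have hA : x ⬝ᵥ Aᵀ *ᵥ (P *ᵥ x) = x ⬝ᵥ P *ᵥ (A *ᵥ x) := by
    rw [dotProduct_mulVec, vecMul_transpose, hP.dotProduct_mulVec_comm]
  have hC : x ⬝ᵥ Cᵀ *ᵥ (C *ᵥ x) = (C *ᵥ x) ⬝ᵥ (C *ᵥ x) := by
    rw [dotProduct_mulVec, vecMul_transpose]
  simp only [star_trivial, neg_mulVec, dotProduct_neg, add_mulVec, dotProduct_add,
    ← mulVec_mulVec, hA, hC] at hx
  linarith

/-- Semidefinite Lyapunov inequality with observability: if there is a symmetric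
positive definite `P` with `Aᵀ P + P A + Cᵀ C ⪯ 0` and `(C, A)` is PBH observable,
then `A` is Hurwitz. -/
theorem lyapunov_semidef_observable_hurwitz {n p : ℕ}
    (A : Matrix (Fin n) (Fin n) ℝ) (C : Matrix (Fin p) (Fin n) ℝ)
    (h : ∃ P : Matrix (Fin n) (Fin n) ℝ, P.IsSymm ∧ P.PosDef ∧
      (-(Aᵀ * P + P * A + Cᵀ * C)).PosSemidef)
    (hobs : PBHObservable C A) :
    IsHurwitz A := by
  obtain ⟨P, hsymm, hpos, hneg⟩ := h
  intro lam hlam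
  rw [← spectrum_toLin', ← Module.End.hasEigenvalue_iff_mem_spectrum] at hlam
  obtain ⟨v, hv⟩ := hlam.exists_hasEigenvector
  have hAv : A.map (algebraMap ℝ ℂ) *ᵥ v = lam • v := by
    simpa only [toLin'_apply] using hv.apply_eq_smul
  by_contra! hre
  refine hobs lam v hv.2 hAv ?_
  set x : Fin n → ℝ := fun j => (v j).re with hx
  set y : Fin n → ℝ := fun j => (v j).im with hy
  have hAx : A *ᵥ x = lam.re • x - lam.im • y := by
    ext i
    rw [hx, ← re_map_mulVec, hAv]
    simp [hy]
  have hAy : A *ᵥ y = lam.re • y + lam.im • x := by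
    ext i
    rw [hy, ← im_map_mulVec, hAv]
    simp [hx]
  have hLx := lyapunov_inequality_apply hsymm hneg x
  have hLy := lyapunov_inequality_apply hsymm hneg y
  rw [hAx, mulVec_sub, mulVec_smul, mulVec_smul, dotProduct_sub, dotProduct_smul,
    dotProduct_smul, smul_eq_mul, smul_eq_mul] at hLx
  rw [hAy, mulVec_add, mulVec_smul, mulVec_smul, dotProduct_add, dotProduct_smul,
    dotProduct_smul, smul_eq_mul, smul_eq_mul, hsymm.dotProduct_mulVec_comm y x] at hLy
  have hPx : 0 ≤ x ⬝ᵥ P *ᵥ x := hpos.posSemidef.dotProduct_mulVec_nonneg x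
  have hPy : 0 ≤ y ⬝ᵥ P *ᵥ y := hpos.posSemidef.dotProduct_mulVec_nonneg y
  have hCx : 0 ≤ (C *ᵥ x) ⬝ᵥ (C *ᵥ x) := dotProduct_self_star_nonneg _
  have hCy : 0 ≤ (C *ᵥ y) ⬝ᵥ (C *ᵥ y) := dotProduct_self_star_nonneg _
  have hmx := mul_nonneg hre hPx
  have hmy := mul_nonneg hre hPy
  have hCx0 : C *ᵥ x = 0 := dotProduct_self_eq_zero.mp (by linarith)
  have hCy0 : C *ᵥ y = 0 := dotProduct_self_eq_zero.mp (by linarith)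
  ext i
  apply Complex.ext
  · rw [re_map_mulVec]
    exact congrFun hCx0 i
  · rw [im_map_mulVec]
    exact congrFun hCy0 i
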